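/- Let u : ℝ³ → ℝ be a smooth solution of the rdDym equation u_ty = u_x u_xy − u_y u_xx with u_y nowhere vanishing, and let q : ℝ³ → ℝ be any smooth function satisfying ∂_t q = u_x / u_y and ∂_x q = 1 / u_y at every point. Then the function ψ₋₁ := q u_y + x satisfies the linearized rdDym equation ℓ_E(ψ₋₁) := ∂_t∂_y ψ₋₁ − u_x ∂_x∂_y ψ₋₁ + u_y ∂_x² ψ₋₁ − u_xy ∂_x ψ₋₁ + u_xx ∂_y ψ₋₁ = 0 at every point of ℝ³. (ψ₋₁ is a nonlocal shadow of a symmetry of the rdDym equation in its positive covering.) -/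

import Mathlib

noncomputable section

/-- Partial derivative with respect to the first variable (`x`). -/
def Dx (f : ℝ → ℝ → ℝ → ℝ) (x y t : ℝ) : ℝ := deriv (fun x' => f x' y t) x

/-- Partial derivative with respect to the second variable (`y`). -/
def Dy (f : ℝ → ℝ → ℝ → ℝ) (x y t : ℝ) : ℝ := deriv (fun y' => f x y' t) y

/-- Partial derivative with respect to the third variable (`t`). -/
def Dt (f : ℝ → ℝ → ℝ → ℝ) (x y t : ℝ) : ℝ := deriv (fun t' => f x y t') t

/-- Smoothness of a function of three real variables `(x, y, t)`. -/
def Smooth3 (f : ℝ → ℝ → ℝ → ℝ) : Prop :=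
  ContDiff ℝ (⊤ : ℕ∞) (fun p : ℝ × ℝ × ℝ => f p.1 p.2.1 p.2.2)

/-- Linearization of the rdDym equation `u_ty = u_x u_xy - u_y u_xx` at a solution `u`. -/
def linRdDym (u φ : ℝ → ℝ → ℝ → ℝ) (x y t : ℝ) : ℝ :=
  Dt (Dy φ) x y t - Dx u x y t * Dx (Dy φ) x y t + Dy u x y t * Dx (Dx φ) x y t
    - Dx (Dy u) x y t * Dx φ x y t + Dx (Dx u) x y t * Dy φ x y t

theorem Smooth3.hasFDerivAt {f : ℝ → ℝ → ℝ → ℝ} (hf : Smooth3 f) (p : ℝ × ℝ × ℝ) :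
    HasFDerivAt (fun p : ℝ × ℝ × ℝ => f p.1 p.2.1 p.2.2)
      (fderiv ℝ (fun p : ℝ × ℝ × ℝ => f p.1 p.2.1 p.2.2) p) p :=
  (hf.differentiable (by simp) p).hasFDerivAt

theorem Smooth3.hasDerivAt_fderiv_x {f : ℝ → ℝ → ℝ → ℝ} (hf : Smooth3 f) (x y t : ℝ) :
    HasDerivAt (fun a => f a y t)
      (fderiv ℝ (fun p : ℝ × ℝ × ℝ => f p.1 p.2.1 p.2.2) (x, y, t) (1, 0, 0)) x :=
  (hf.hasFDerivAt (x, y, t)).comp_hasDerivAt x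
    (f := fun a : ℝ => (a, y, t)) ((hasDerivAt_id x).prodMk (hasDerivAt_const x (y, t)))

theorem Smooth3.hasDerivAt_fderiv_y {f : ℝ → ℝ → ℝ → ℝ} (hf : Smooth3 f) (x y t : ℝ) :
    HasDerivAt (fun b => f x b t)
      (fderiv ℝ (fun p : ℝ × ℝ × ℝ => f p.1 p.2.1 p.2.2) (x, y, t) (0, 1, 0)) y :=
  (hf.hasFDerivAt (x, y, t)).comp_hasDerivAt y (f := fun b : ℝ => (x, b, t))
    ((hasDerivAt_const y x).prodMk ((hasDerivAt_id y).prodMk (hasDerivAt_const y t)))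

theorem Smooth3.hasDerivAt_fderiv_t {f : ℝ → ℝ → ℝ → ℝ} (hf : Smooth3 f) (x y t : ℝ) :
    HasDerivAt (fun c => f x y c)
      (fderiv ℝ (fun p : ℝ × ℝ × ℝ => f p.1 p.2.1 p.2.2) (x, y, t) (0, 0, 1)) t :=
  (hf.hasFDerivAt (x, y, t)).comp_hasDerivAt t (f := fun c : ℝ => (x, y, c))
    ((hasDerivAt_const t x).prodMk ((hasDerivAt_const t y).prodMk (hasDerivAt_id t)))

theorem Smooth3.hasDerivAt_x {f : ℝ → ℝ → ℝ → ℝ} (hf : Smooth3 f) (x y t : ℝ) :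
    HasDerivAt (fun a => f a y t) (Dx f x y t) x :=
  (hf.hasDerivAt_fderiv_x x y t).differentiableAt.hasDerivAt

theorem Smooth3.hasDerivAt_y {f : ℝ → ℝ → ℝ → ℝ} (hf : Smooth3 f) (x y t : ℝ) :
    HasDerivAt (fun b => f x b t) (Dy f x y t) y :=
  (hf.hasDerivAt_fderiv_y x y t).differentiableAt.hasDerivAt

theorem Smooth3.hasDerivAt_t {f : ℝ → ℝ → ℝ → ℝ} (hf : Smooth3 f) (x y t : ℝ) :
    HasDerivAt (fun c => f x y c) (Dt f x y t) t :=
  (hf.hasDerivAt_fderiv_t x y t).differentiableAt.hasDerivAt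

theorem Smooth3.Dx_eq {f : ℝ → ℝ → ℝ → ℝ} (hf : Smooth3 f) :
    Dx f = fun x y t =>
      fderiv ℝ (fun p : ℝ × ℝ × ℝ => f p.1 p.2.1 p.2.2) (x, y, t) (1, 0, 0) := by
  funext x y t
  exact (hf.hasDerivAt_fderiv_x x y t).deriv

theorem Smooth3.Dy_eq {f : ℝ → ℝ → ℝ → ℝ} (hf : Smooth3 f) :
    Dy f = fun x y t =>
      fderiv ℝ (fun p : ℝ × ℝ × ℝ => f p.1 p.2.1 p.2.2) (x, y, t) (0, 1, 0) := by
  funext x y t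
  exact (hf.hasDerivAt_fderiv_y x y t).deriv

theorem Smooth3.Dt_eq {f : ℝ → ℝ → ℝ → ℝ} (hf : Smooth3 f) :
    Dt f = fun x y t =>
      fderiv ℝ (fun p : ℝ × ℝ × ℝ => f p.1 p.2.1 p.2.2) (x, y, t) (0, 0, 1) := by
  funext x y t
  exact (hf.hasDerivAt_fderiv_t x y t).deriv

theorem Smooth3.fderiv_apply {f : ℝ → ℝ → ℝ → ℝ} (hf : Smooth3 f) (v : ℝ × ℝ × ℝ) :
    Smooth3 fun x y t =>
      fderiv ℝ (fun p : ℝ × ℝ × ℝ => f p.1 p.2.1 p.2.2) (x, y, t) v :=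
  (ContDiff.fderiv_right hf (m := (⊤ : ℕ∞)) (by simp)).clm_apply contDiff_const

theorem Smooth3.dx {f : ℝ → ℝ → ℝ → ℝ} (hf : Smooth3 f) : Smooth3 (Dx f) := by
  rw [hf.Dx_eq]
  exact hf.fderiv_apply _

theorem Smooth3.dy {f : ℝ → ℝ → ℝ → ℝ} (hf : Smooth3 f) : Smooth3 (Dy f) := by
  rw [hf.Dy_eq]
  exact hf.fderiv_apply _

theorem Smooth3.dt {f : ℝ → ℝ → ℝ → ℝ} (hf : Smooth3 f) : Smooth3 (Dt f) := by
  rw [hf.Dt_eq]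
  exact hf.fderiv_apply _

theorem Smooth3.fderiv_fderiv_comm {f : ℝ → ℝ → ℝ → ℝ} (hf : Smooth3 f)
    (p v w : ℝ × ℝ × ℝ) :
    fderiv ℝ (fun p => fderiv ℝ (fun p : ℝ × ℝ × ℝ => f p.1 p.2.1 p.2.2) p v) p w =
      fderiv ℝ (fun p => fderiv ℝ (fun p : ℝ × ℝ × ℝ => f p.1 p.2.1 p.2.2) p w) p v := by
  have hd : DifferentiableAt ℝ (fderiv ℝ fun p : ℝ × ℝ × ℝ => f p.1 p.2.1 p.2.2) p :=
    (ContDiff.fderiv_right hf (m := (⊤ : ℕ∞)) (by simp)).differentiable (by simp) p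
  have hs : IsSymmSndFDerivAt ℝ (fun p : ℝ × ℝ × ℝ => f p.1 p.2.1 p.2.2) p :=
    (ContDiff.contDiffAt hf).isSymmSndFDerivAt (by
      simpa using (WithTop.coe_le_coe.2 le_top : ((2 : ℕ∞) : WithTop ℕ∞) ≤ ((⊤ : ℕ∞) : WithTop ℕ∞)))
  rw [fderiv_clm_apply hd (by fun_prop), fderiv_clm_apply hd (by fun_prop)]
  simpa using hs.eq w v

theorem Smooth3.Dx_Dy_comm {f : ℝ → ℝ → ℝ → ℝ} (hf : Smooth3 f) :
    Dx (Dy f) = Dy (Dx f) := by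
  rw [hf.dy.Dx_eq, hf.dx.Dy_eq, hf.Dx_eq, hf.Dy_eq]
  funext x y t
  exact hf.fderiv_fderiv_comm _ _ _

theorem Smooth3.Dt_Dy_comm {f : ℝ → ℝ → ℝ → ℝ} (hf : Smooth3 f) :
    Dt (Dy f) = Dy (Dt f) := by
  rw [hf.dy.Dt_eq, hf.dt.Dy_eq, hf.Dt_eq, hf.Dy_eq]
  funext x y t
  exact hf.fderiv_fderiv_comm _ _ _

/-- The nonlocal shadow `ψ₋₁ = q u_y + x` of the rdDym equation in the positive covering. -/
theorem rdDym_nonlocal_shadow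
    (u : ℝ → ℝ → ℝ → ℝ) (hu : Smooth3 u)
    (husol : ∀ x y t : ℝ, Dt (Dy u) x y t = Dx u x y t * Dx (Dy u) x y t - Dy u x y t * Dx (Dx u) x y t)
    (huy : ∀ x y t : ℝ, Dy u x y t ≠ 0)
    (q : ℝ → ℝ → ℝ → ℝ) (hq : Smooth3 q)
    (hqt : ∀ x y t : ℝ, Dt q x y t = Dx u x y t / Dy u x y t)
    (hqx : ∀ x y t : ℝ, Dx q x y t = 1 / Dy u x y t) :
    ∀ x y t : ℝ,
      linRdDym u (fun a b c => q a b c * Dy u a b c + a) x y t = 0 := by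
  have hp := hu.dy
  have hpx : Dy (Dx u) = Dx (Dy u) := hu.Dx_Dy_comm.symm
  have hpxx : Dy (Dx (Dx u)) = Dx (Dx (Dy u)) := by rw [← hu.dx.Dx_Dy_comm, hpx]
  have hφx : Dx (fun a b c => q a b c * Dy u a b c + a) =
      fun a b c => q a b c * Dx (Dy u) a b c + 2 := by
    funext a b c
    refine (((hq.hasDerivAt_x a b c).mul (hp.hasDerivAt_x a b c)).add
      (hasDerivAt_id a)).deriv.trans ?_
    rw [hqx, one_div_mul_cancel (huy a b c)]
    ring
  have hφy : Dy (fun a b c => q a b c * Dy u a b c + a) =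
      fun a b c => Dy q a b c * Dy u a b c + q a b c * Dy (Dy u) a b c := by
    funext a b c
    exact (((hq.hasDerivAt_y a b c).mul (hp.hasDerivAt_y a b c)).add_const a).deriv
  intro x y t
  have hφxx : Dx (fun a b c => q a b c * Dx (Dy u) a b c + 2) x y t =
      Dx q x y t * Dx (Dy u) x y t + q x y t * Dx (Dx (Dy u)) x y t :=
    (((hq.hasDerivAt_x x y t).mul (hp.dx.hasDerivAt_x x y t)).add_const 2).deriv
  have hφxy : Dx (fun a b c => Dy q a b c * Dy u a b c + q a b c * Dy (Dy u) a b c) x y t =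
      (Dx (Dy q) x y t * Dy u x y t + Dy q x y t * Dx (Dy u) x y t) +
        (Dx q x y t * Dy (Dy u) x y t + q x y t * Dx (Dy (Dy u)) x y t) :=
    (((hq.dy.hasDerivAt_x x y t).mul (hp.hasDerivAt_x x y t)).add
      ((hq.hasDerivAt_x x y t).mul (hp.dy.hasDerivAt_x x y t))).deriv
  have hφty : Dt (fun a b c => Dy q a b c * Dy u a b c + q a b c * Dy (Dy u) a b c) x y t =
      (Dt (Dy q) x y t * Dy u x y t + Dy q x y t * Dt (Dy u) x y t) +
        (Dt q x y t * Dy (Dy u) x y t + q x y t * Dt (Dy (Dy u)) x y t) :=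
    (((hq.dy.hasDerivAt_t x y t).mul (hp.hasDerivAt_t x y t)).add
      ((hq.hasDerivAt_t x y t).mul (hp.dy.hasDerivAt_t x y t))).deriv
  have hqxy : Dx (Dy q) x y t = -Dy (Dy u) x y t / Dy u x y t ^ 2 := by
    rw [hq.Dx_Dy_comm, show Dx q = fun a b c => (Dy u a b c)⁻¹ by
      funext a b c; rw [hqx, one_div]]
    exact ((hp.hasDerivAt_y x y t).inv (huy x y t)).deriv
  have hqty : Dt (Dy q) x y t =
      (Dx (Dy u) x y t * Dy u x y t - Dx u x y t * Dy (Dy u) x y t) / Dy u x y t ^ 2 := by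
    rw [hq.Dt_Dy_comm, show Dt q = fun a b c => Dx u a b c / Dy u a b c by
      funext a b c; rw [hqt], ← hpx]
    exact ((hu.dx.hasDerivAt_y x y t).div (hp.hasDerivAt_y x y t) (huy x y t)).deriv
  have huty : Dt (Dy (Dy u)) x y t =
      (Dx (Dy u) x y t * Dx (Dy u) x y t + Dx u x y t * Dx (Dy (Dy u)) x y t) -
        (Dy (Dy u) x y t * Dx (Dx u) x y t + Dy u x y t * Dx (Dx (Dy u)) x y t) := by
    rw [hp.Dt_Dy_comm, show Dt (Dy u) = fun a b c =>
        Dx u a b c * Dx (Dy u) a b c - Dy u a b c * Dx (Dx u) a b c by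
      funext a b c; rw [husol], hp.Dx_Dy_comm, ← hpxx]
    have h := (((hu.dx.hasDerivAt_y x y t).mul (hp.dx.hasDerivAt_y x y t)).sub
      ((hp.hasDerivAt_y x y t).mul (hu.dx.dx.hasDerivAt_y x y t))).deriv
    rw [hpx] at h
    exact h
  have hne := huy x y t
  unfold linRdDym
  rw [hφx, hφy, hφxx, hφxy, hφty, hqxy, hqty, huty, husol, hqt, hqx]
  field_simp
  ring
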